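/- With the q-quadratic lattice, the operators D_x, S_x, and the Pearson data as in the context, let u be a nonzero regular ℂ-linear functional satisfying u(φ·D_xf) + u(ψ·S_xf) = 0 for every polynomial f, and let (P_n) be its monic OPS. Then the functional Rodrigues formula holds: for every n ≥ 0 and every polynomial g, u(P_n·g) = k_n·(−1)^n·u^{[n]}(D_x^n g), where k_n := (−α)^{−n}·∏_{j=1}^{n} d_{n+j−2}^{−1} and u^{[n]} is the n-th functional defined recursively in the context. -/

import Mathlib

open Polynomial

noncomputable def qp (q : ℝ) (t : ℂ) : ℂ := Complex.exp (t * (Real.log q : ℂ))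

noncomputable def alphaL (q : ℝ) : ℂ := (qp q (1/2) + qp q (-(1/2))) / 2

noncomputable def alphaN (q : ℝ) (n : ℕ) : ℂ :=
  (qp q ((n : ℂ) / 2) + qp q (-((n : ℂ) / 2))) / 2

noncomputable def gammaN (q : ℝ) (n : ℕ) : ℂ :=
  (qp q ((n : ℂ) / 2) - qp q (-((n : ℂ) / 2))) / (qp q (1/2) - qp q (-(1/2)))

noncomputable def latX (q : ℝ) (c1 c2 c3 s : ℂ) : ℂ := c1 * qp q (-s) + c2 * qp q s + c3

noncomputable def U1L (q : ℝ) (c3 : ℂ) : Polynomial ℂ :=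
  Polynomial.C (alphaL q ^ 2 - 1) * (Polynomial.X - Polynomial.C c3)

noncomputable def U2L (q : ℝ) (c1 c2 c3 : ℂ) : Polynomial ℂ :=
  Polynomial.C (alphaL q ^ 2 - 1) *
    ((Polynomial.X - Polynomial.C c3) ^ 2 - Polynomial.C (4 * c1 * c2))

noncomputable def dN (q : ℝ) (pa pd : ℂ) (n : ℕ) : ℂ := pa * gammaN q n + pd * alphaN q n

noncomputable def eN (q : ℝ) (pa pb pd pe c3 : ℂ) (n : ℕ) : ℂ :=
  (2 * pa * c3 + pb) * gammaN q n + (pd * c3 + pe) * alphaN q n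

/-- The polynomial `U₁` attached to a lattice with parameters `α`, `c`. -/
noncomputable def latticeU₁ (α c : ℂ) : ℂ[X] := C (α ^ 2 - 1) * (X - C c)

/-- The polynomial `U₂` attached to a lattice with parameters `α`, `c`, `κ`. -/
noncomputable def latticeU₂ (α c κ : ℂ) : ℂ[X] := C (α ^ 2 - 1) * ((X - C c) ^ 2 - C κ)

/-- The first-order rules satisfied by the divided-difference operator `D` and the averaging
operator `S` of a quadratic lattice. -/
structure IsLatticeCalculus (α c κ : ℂ) (D S : ℂ[X] →ₗ[ℂ] ℂ[X]) : Prop where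
  D_X : D X = 1
  S_X : S X = C α * (X - C c) + C c
  S_one : S 1 = 1
  D_mul : ∀ f g, D (f * g) = D f * S g + S f * D g
  S_mul : ∀ f g, S (f * g) = latticeU₂ α c κ * D f * D g + S f * S g

namespace IsLatticeCalculus

variable {α c κ : ℂ} {D S : ℂ[X] →ₗ[ℂ] ℂ[X]}

theorem D_C (h : IsLatticeCalculus α c κ D S) (a : ℂ) : D (C a) = 0 := by
  have h1 : D 1 = 0 := by
    have := h.D_mul 1 1
    rw [h.S_one, mul_one, mul_one, one_mul] at this
    simpa using this
  rw [← mul_one (C a), ← smul_eq_C_mul, map_smul, h1, smul_zero]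

theorem S_C (h : IsLatticeCalculus α c κ D S) (a : ℂ) : S (C a) = C a := by
  rw [← mul_one (C a), ← smul_eq_C_mul, map_smul, h.S_one]

theorem D_C_mul (_h : IsLatticeCalculus α c κ D S) (a : ℂ) (f : ℂ[X]) :
    D (C a * f) = C a * D f := by
  rw [← smul_eq_C_mul, map_smul, smul_eq_C_mul]

theorem S_C_mul (_h : IsLatticeCalculus α c κ D S) (a : ℂ) (f : ℂ[X]) :
    S (C a * f) = C a * S f := by
  rw [← smul_eq_C_mul, map_smul, smul_eq_C_mul]

theorem D_U₁ (h : IsLatticeCalculus α c κ D S) : D (latticeU₁ α c) = C (α ^ 2 - 1) := by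
  rw [latticeU₁, h.D_C_mul, LinearMap.map_sub, h.D_X, h.D_C, sub_zero, mul_one]

theorem S_U₁ (h : IsLatticeCalculus α c κ D S) :
    S (latticeU₁ α c) = C α * latticeU₁ α c := by
  rw [latticeU₁, h.S_C_mul, LinearMap.map_sub, h.S_X, h.S_C]
  ring

theorem D_U₂ (h : IsLatticeCalculus α c κ D S) :
    D (latticeU₂ α c κ) = 2 * C α * latticeU₁ α c := by
  rw [latticeU₂, latticeU₁, h.D_C_mul]
  simp only [pow_two (X - C c), map_sub, h.D_mul, h.D_X, h.S_X, h.S_C, h.D_C]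
  ring

theorem S_U₂ (h : IsLatticeCalculus α c κ D S) :
    S (latticeU₂ α c κ) = C α ^ 2 * latticeU₂ α c κ + latticeU₁ α c ^ 2 := by
  rw [latticeU₂, latticeU₁, h.S_C_mul]
  simp only [latticeU₂, pow_two (X - C c), map_sub, h.S_mul, h.D_X, h.S_X, h.S_C, h.D_C,
    map_pow, map_one]
  ring

theorem D_S (h : IsLatticeCalculus α c κ D S) (f : ℂ[X]) :
    D (S f) = C α * S (D f) + latticeU₁ α c * D (D f) := by
  induction f using Polynomial.induction_on with
  | C a => simp [h.S_C, h.D_C]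
  | add p q hp hq => simp only [map_add, hp, hq]; ring
  | monomial n a ih =>
    rw [pow_succ, ← mul_assoc]
    generalize C a * X ^ n = f at ih ⊢
    simp only [h.S_mul, h.D_mul, h.D_X, h.S_X, h.D_U₂, h.S_U₂, ih, map_add, map_sub,
      h.D_C, h.S_C, mul_one]
    ring

theorem S_S (h : IsLatticeCalculus α c κ D S) (f : ℂ[X]) :
    S (S f) = latticeU₁ α c * S (D f) + C α * latticeU₂ α c κ * D (D f) + f := by
  induction f using Polynomial.induction_on with
  | C a => simp [h.S_C, h.D_C]
  | add p q hp hq => simp only [map_add, hp, hq]; ring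
  | monomial n a ih =>
    rw [pow_succ, ← mul_assoc]
    generalize C a * X ^ n = f at ih ⊢
    simp only [h.S_mul, h.D_mul, h.D_X, h.S_X, h.D_U₂, h.S_U₂, ih, map_add, map_sub, h.D_S,
      h.D_C, h.S_C, mul_one]
    simp only [latticeU₁, map_sub, map_pow, map_one]
    ring

theorem U₁_sq (α c κ : ℂ) :
    latticeU₁ α c ^ 2 = (C α ^ 2 - 1) * latticeU₂ α c κ + C ((α ^ 2 - 1) ^ 2 * κ) := by
  simp only [latticeU₁, latticeU₂, map_sub, map_pow, map_one, map_mul]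
  ring

/-- The shifted functional applied to a divided difference. -/
theorem shift_D (h : IsLatticeCalculus α c κ D S) {u v : ℂ[X] →ₗ[ℂ] ℂ} {φ ψ : ℂ[X]}
    (hu : ∀ f, u (φ * D f) + u (ψ * S f) = 0)
    (hv : ∀ f, v f = -(u (latticeU₂ α c κ * ψ * D f)) - u (φ * S f)) (g : ℂ[X]) :
    v (D g) = α * u (ψ * g) := by
  have key := hu (C α * S g - latticeU₁ α c * D g)
  rw [← map_add] at key
  have e : φ * D (C α * S g - latticeU₁ α c * D g) + ψ * S (C α * S g - latticeU₁ α c * D g)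
      = latticeU₂ α c κ * ψ * D (D g) + φ * S (D g) + α • (ψ * g) := by
    simp only [LinearMap.map_sub, h.D_C_mul, h.S_C_mul, h.D_mul, h.S_mul, h.D_U₁, h.S_U₁, h.D_S, h.S_S,
      smul_eq_C_mul, C_sub, C_pow, C_1]
    ring
  rw [e, map_add, map_add, map_smul, smul_eq_mul] at key
  rw [hv]
  linear_combination -key

/-- The shifted functional applied to an average. -/
theorem shift_S (h : IsLatticeCalculus α c κ D S) {u v : ℂ[X] →ₗ[ℂ] ℂ} {φ ψ : ℂ[X]}
    (hu : ∀ f, u (φ * D f) + u (ψ * S f) = 0)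
    (hv : ∀ f, v f = -(u (latticeU₂ α c κ * ψ * D f)) - u (φ * S f)) (g : ℂ[X]) :
    v (S g) = -u ((C α ^ 2 * φ + C α * latticeU₁ α c * ψ) * g) := by
  set w := C α * ((latticeU₂ α c κ - C ((α ^ 2 - 1) ^ 2 * κ)) * D g)
    - C α * S (latticeU₁ α c * g) + latticeU₁ α c * D (latticeU₁ α c * g) with hw
  have key := hu w
  rw [← map_add] at key
  have e : φ * D w + ψ * S w = latticeU₂ α c κ * ψ * D (S g) + φ * S (S g)
      - (C α ^ 2 * φ + C α * latticeU₁ α c * ψ) * g := by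
    simp only [hw, LinearMap.map_sub, LinearMap.map_add, h.D_C_mul, h.S_C_mul, h.D_mul, h.S_mul, h.D_U₁, h.S_U₁,
      h.D_U₂, h.S_U₂, h.D_S, h.S_S, h.D_C, h.S_C]
    simp only [C_sub (a := α ^ 2), C_pow (a := α), C_1]
    rw [eq_sub_of_add_eq' (U₁_sq α c κ).symm]
    ring
  rw [e, map_sub, map_add] at key
  rw [hv]
  linear_combination -key

theorem shift_mul_D (h : IsLatticeCalculus α c κ D S) (hα : α ≠ 0) {u v : ℂ[X] →ₗ[ℂ] ℂ}
    {φ ψ : ℂ[X]} (hu : ∀ f, u (φ * D f) + u (ψ * S f) = 0)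
    (hv : ∀ f, v f = -(u (latticeU₂ α c κ * ψ * D f)) - u (φ * S f)) (f g : ℂ[X]) :
    v (f * D g) = α * u ((φ * D f + ψ * S f) * g) := by
  have e : α • (f * D g) = D ((C α * S f - latticeU₁ α c * D f) * g) - S (g * D f) := by
    simp only [LinearMap.map_sub, h.D_C_mul, h.S_C_mul, h.D_mul, h.S_mul, h.D_U₁, h.S_U₁, h.D_S, h.S_S,
      smul_eq_C_mul, C_sub, C_pow, C_1]
    ring
  have e2 := congrArg v e
  rw [map_smul, map_sub, h.shift_D hu hv, h.shift_S hu hv, smul_eq_mul] at e2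
  apply mul_left_cancel₀ hα
  rw [e2, sub_neg_eq_add]
  simp only [← smul_eq_mul, ← map_smul, ← map_add]
  congr 1
  simp only [smul_eq_C_mul]
  ring

theorem shift_mul_S (h : IsLatticeCalculus α c κ D S) (hα : α ≠ 0) {u v : ℂ[X] →ₗ[ℂ] ℂ}
    {φ ψ : ℂ[X]} (hu : ∀ f, u (φ * D f) + u (ψ * S f) = 0)
    (hv : ∀ f, v f = -(u (latticeU₂ α c κ * ψ * D f)) - u (φ * S f)) (f g : ℂ[X]) :
    v (f * S g) = -(α * u (((C α * φ + latticeU₁ α c * ψ) * S f +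
      (latticeU₁ α c * φ + C α * latticeU₂ α c κ * ψ) * D f) * g)) := by
  have e : α • (f * S g) = S ((C α * S f - latticeU₁ α c * D f) * g)
      - latticeU₂ α c κ * D (g * D f) := by
    simp only [LinearMap.map_sub, h.D_C_mul, h.S_C_mul, h.D_mul, h.S_mul, h.D_U₁, h.S_U₁, h.D_S, h.S_S,
      smul_eq_C_mul, C_sub, C_pow, C_1]
    ring
  have e2 := congrArg v e
  rw [map_smul, map_sub, h.shift_mul_D hα hu hv, h.shift_S hu hv, smul_eq_mul] at e2
  apply mul_left_cancel₀ hα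
  rw [e2]
  simp only [← smul_eq_mul, ← map_smul, ← map_neg, ← map_sub]
  congr 1
  simp only [smul_eq_C_mul, h.D_U₂, h.S_U₂]
  ring

/-- The shifted functional satisfies a Pearson equation with the shifted data. -/
theorem shift_pearson (h : IsLatticeCalculus α c κ D S) (hα : α ≠ 0) {u v : ℂ[X] →ₗ[ℂ] ℂ}
    {φ ψ φ' ψ' : ℂ[X]} (hu : ∀ f, u (φ * D f) + u (ψ * S f) = 0)
    (hv : ∀ f, v f = -(u (latticeU₂ α c κ * ψ * D f)) - u (φ * S f))
    (hφ : φ' = S φ + latticeU₁ α c * S ψ + C α * latticeU₂ α c κ * D ψ)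
    (hψ : ψ' = D φ + C α * S ψ + latticeU₁ α c * D ψ) (f : ℂ[X]) :
    v (φ' * D f) + v (ψ' * S f) = 0 := by
  rw [h.shift_mul_D hα hu hv, h.shift_mul_S hα hu hv, ← sub_eq_add_neg, ← mul_sub, ← map_sub,
    ← sub_mul]
  have e : φ * D φ' + ψ * S φ' - ((C α * φ + latticeU₁ α c * ψ) * S ψ' +
      (latticeU₁ α c * φ + C α * latticeU₂ α c κ * ψ) * D ψ') = 0 := by
    simp only [hφ, hψ, map_add, mul_assoc, h.D_C_mul, h.S_C_mul, h.D_mul, h.S_mul, h.D_U₁,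
      h.S_U₁, h.D_U₂, h.S_U₂, h.D_S, h.S_S, C_sub, C_pow, C_1]
    ring
  rw [e, zero_mul, map_zero, mul_zero]

end IsLatticeCalculus

/-- `f` has degree at most `n` and its coefficient of degree `n` is `a`. -/
def HasTopCoeff (f : ℂ[X]) (n : ℕ) (a : ℂ) : Prop := f.natDegree ≤ n ∧ f.coeff n = a

namespace HasTopCoeff

variable {f g : ℂ[X]} {m n : ℕ} {a b : ℂ}

theorem add (hf : HasTopCoeff f n a) (hg : HasTopCoeff g n b) : HasTopCoeff (f + g) n (a + b) :=
  ⟨natDegree_add_le_of_degree_le hf.1 hg.1, by rw [coeff_add, hf.2, hg.2]⟩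

theorem mul (hf : HasTopCoeff f m a) (hg : HasTopCoeff g n b) :
    HasTopCoeff (f * g) (m + n) (a * b) :=
  ⟨natDegree_mul_le_of_le hf.1 hg.1, by
    rw [coeff_mul_add_eq_of_natDegree_le hf.1 hg.1, hf.2, hg.2]⟩

theorem C_mul (hf : HasTopCoeff f n a) (c : ℂ) : HasTopCoeff (C c * f) n (c * a) :=
  ⟨(natDegree_C_mul_le c f).trans hf.1, by rw [coeff_C_mul, hf.2]⟩

theorem neg (hf : HasTopCoeff f n a) : HasTopCoeff (-f) n (-a) :=
  ⟨by rw [natDegree_neg]; exact hf.1, by rw [coeff_neg, hf.2]⟩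

theorem of_lt (hf : f.natDegree < n) : HasTopCoeff f n 0 :=
  ⟨hf.le, coeff_eq_zero_of_natDegree_lt hf⟩

theorem X_sub_C (c : ℂ) : HasTopCoeff (X - C c) 1 1 :=
  ⟨natDegree_X_sub_C_le c, by simp⟩

end HasTopCoeff

theorem hasTopCoeff_latticeU₁ (α c : ℂ) : HasTopCoeff (latticeU₁ α c) 1 (α ^ 2 - 1) := by
  have := (HasTopCoeff.X_sub_C c).C_mul (α ^ 2 - 1)
  rwa [mul_one] at this

theorem hasTopCoeff_latticeU₂ (α c κ : ℂ) : HasTopCoeff (latticeU₂ α c κ) 2 (α ^ 2 - 1) := by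
  have h1 := (HasTopCoeff.X_sub_C c).mul (HasTopCoeff.X_sub_C c)
  have h2 : HasTopCoeff (-C κ) 2 0 := HasTopCoeff.of_lt (by simp)
  have := (h1.add h2).C_mul (α ^ 2 - 1)
  rw [latticeU₂, sub_eq_add_neg ((X - C c) ^ 2), pow_two (X - C c)]
  simpa using this

/-- The recursions satisfied by the sequences `αₙ` and `γₙ` of a quadratic lattice. -/
structure IsLatticeSeq (α : ℂ) (A G : ℕ → ℂ) : Prop where
  A_zero : A 0 = 1
  G_zero : G 0 = 0
  A_succ : ∀ n, A (n + 1) = (α ^ 2 - 1) * G n + α * A n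
  G_succ : ∀ n, G (n + 1) = A n + α * G n

theorem IsLatticeSeq.sq_sub_sq {α : ℂ} {A G : ℕ → ℂ} (hs : IsLatticeSeq α A G) (n : ℕ) :
    A n ^ 2 - (α ^ 2 - 1) * G n ^ 2 = 1 := by
  induction n with
  | zero => simp [hs.A_zero, hs.G_zero]
  | succ n ih => rw [hs.A_succ, hs.G_succ]; linear_combination ih

namespace IsLatticeCalculus

variable {α c κ : ℂ} {D S : ℂ[X] →ₗ[ℂ] ℂ[X]} {A G : ℕ → ℂ}

theorem hasTopCoeff_S_X (h : IsLatticeCalculus α c κ D S) : HasTopCoeff (S X) 1 α := by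
  have := ((HasTopCoeff.X_sub_C c).C_mul α).add (HasTopCoeff.of_lt (f := C c) (by simp))
  rw [h.S_X]
  simpa using this

theorem D_eq_zero (h : IsLatticeCalculus α c κ D S) {f : ℂ[X]} (hf : f.natDegree = 0) :
    D f = 0 := by
  rw [eq_C_of_natDegree_eq_zero hf, h.D_C]

theorem hasTopCoeff_succ (h : IsLatticeCalculus α c κ D S) (hs : IsLatticeSeq α A G) (n : ℕ) :
    ∀ {f : ℂ[X]} {a : ℂ}, HasTopCoeff f (n + 1) a →
      HasTopCoeff (D f) n (G (n + 1) * a) ∧ HasTopCoeff (S f) (n + 1) (A (n + 1) * a) := by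
  induction n with
  | zero =>
    intro f a hf
    have e := eq_X_add_C_of_natDegree_le_one hf.1
    rw [show f.coeff 1 = a from hf.2] at e
    rw [e, map_add, map_add, h.D_C_mul, h.S_C_mul, h.D_C, h.S_C, h.D_X, hs.A_succ, hs.G_succ,
      hs.A_zero, hs.G_zero]
    refine ⟨by simp [HasTopCoeff], ?_⟩
    have := (h.hasTopCoeff_S_X.C_mul a).add (HasTopCoeff.of_lt (f := C (f.coeff 0)) (by simp))
    convert this using 1
    ring
  | succ n ih =>
    intro f a hf
    have hg : HasTopCoeff f.divX (n + 1) a :=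
      ⟨by rw [natDegree_divX_eq_natDegree_tsub_one]; have := hf.1; omega,
        by rw [coeff_divX]; exact hf.2⟩
    obtain ⟨hD, hS⟩ := ih hg
    have hconst (m : ℕ) : HasTopCoeff (C (f.coeff 0)) (m + 1) 0 := HasTopCoeff.of_lt (by simp)
    rw [← divX_mul_X_add f]
    simp only [map_add, h.D_mul, h.S_mul, h.D_C, h.S_C, h.D_X, mul_one, add_zero]
    constructor
    · convert (hD.mul h.hasTopCoeff_S_X).add hS using 1
      rw [hs.G_succ (n + 1)]
      ring
    · have h2 := (hasTopCoeff_latticeU₂ α c κ).mul hD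
      rw [add_comm 2 n] at h2
      convert (h2.add (hS.mul h.hasTopCoeff_S_X)).add (hconst (n + 1)) using 1
      rw [hs.A_succ (n + 1)]
      ring

theorem hasTopCoeff_S (h : IsLatticeCalculus α c κ D S) (hs : IsLatticeSeq α A G) {n : ℕ}
    {f : ℂ[X]} {a : ℂ} (hf : HasTopCoeff f n a) : HasTopCoeff (S f) n (A n * a) := by
  cases n with
  | zero =>
    have e := eq_C_of_natDegree_le_zero hf.1
    rw [hf.2] at e
    rw [e, h.S_C, hs.A_zero]
    simp [HasTopCoeff]
  | succ n => exact (h.hasTopCoeff_succ hs n hf).2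

theorem hasTopCoeff_pearson (h : IsLatticeCalculus α c κ D S) (hs : IsLatticeSeq α A G)
    {φ ψ f : ℂ[X]} {a d l : ℂ} {n : ℕ} (hφ : HasTopCoeff φ 2 a) (hψ : HasTopCoeff ψ 1 d)
    (hf : HasTopCoeff f n l) :
    HasTopCoeff (φ * D f + ψ * S f) (n + 1) ((a * G n + d * A n) * l) := by
  have h1 := hψ.mul (h.hasTopCoeff_S hs hf)
  rw [add_comm 1 n] at h1
  cases n with
  | zero =>
    rw [h.D_eq_zero (Nat.le_zero.1 hf.1), mul_zero, zero_add, hs.G_zero]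
    convert h1 using 1
    ring
  | succ n =>
    have h2 := hφ.mul (h.hasTopCoeff_succ hs n hf).1
    rw [show 2 + n = n + 1 + 1 by ring] at h2
    convert h2.add h1 using 1
    ring

theorem hasTopCoeff_shift_phi (h : IsLatticeCalculus α c κ D S) (hs : IsLatticeSeq α A G)
    {φ ψ : ℂ[X]} {a d : ℂ} (hφ : HasTopCoeff φ 2 a) (hψ : HasTopCoeff ψ 1 d) :
    HasTopCoeff (S φ + latticeU₁ α c * S ψ + C α * latticeU₂ α c κ * D ψ) 2
      ((2 * α ^ 2 - 1) * a + 2 * α * (α ^ 2 - 1) * d) := by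
  obtain ⟨h1, h2⟩ := h.hasTopCoeff_succ hs 0 hψ
  have h3 := ((h.hasTopCoeff_S hs hφ).add ((hasTopCoeff_latticeU₁ α c).mul h2)).add
    (((hasTopCoeff_latticeU₂ α c κ).C_mul α).mul h1)
  convert h3 using 1
  simp only [hs.A_succ, hs.G_succ, hs.A_zero, hs.G_zero]
  ring

theorem hasTopCoeff_shift_psi (h : IsLatticeCalculus α c κ D S) (hs : IsLatticeSeq α A G)
    {φ ψ : ℂ[X]} {a d : ℂ} (hφ : HasTopCoeff φ 2 a) (hψ : HasTopCoeff ψ 1 d) :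
    HasTopCoeff (D φ + C α * S ψ + latticeU₁ α c * D ψ) 1
      (2 * α * a + (2 * α ^ 2 - 1) * d) := by
  obtain ⟨h1, h2⟩ := h.hasTopCoeff_succ hs 0 hψ
  have h3 := ((h.hasTopCoeff_succ hs 1 hφ).1.add (h2.C_mul α)).add
    ((hasTopCoeff_latticeU₁ α c).mul h1)
  convert h3 using 1
  simp only [hs.A_succ, hs.G_succ, hs.A_zero, hs.G_zero]
  ring

theorem D_surjective (h : IsLatticeCalculus α c κ D S) (hs : IsLatticeSeq α A G)
    (hG : ∀ n, G (n + 1) ≠ 0) : Function.Surjective D := by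
  suffices H : ∀ n, ∀ g : ℂ[X], g.natDegree ≤ n → ∃ f, D f = g from fun g => H _ g le_rfl
  have step (n : ℕ) (g : ℂ[X]) (hg : g.natDegree ≤ n) :
      ∃ f, HasTopCoeff (g - D f) n 0 := by
    have hX : HasTopCoeff (X ^ (n + 1) : ℂ[X]) (n + 1) 1 := by simp [HasTopCoeff]
    refine ⟨C (g.coeff n / G (n + 1)) * X ^ (n + 1), ?_⟩
    have h1 := ((h.hasTopCoeff_succ hs n hX).1.C_mul (g.coeff n / G (n + 1))).neg
    rw [h.D_C_mul, sub_eq_add_neg]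
    convert HasTopCoeff.add ⟨hg, rfl⟩ h1 using 1
    field_simp [hG n]
    ring
  intro n
  induction n with
  | zero =>
    intro g hg
    obtain ⟨f, hf⟩ := step 0 g hg
    refine ⟨f, (sub_eq_zero.1 ?_).symm⟩
    rw [eq_C_of_natDegree_le_zero hf.1, hf.2, C_0]
  | succ n ih =>
    intro g hg
    obtain ⟨f, hf⟩ := step (n + 1) g hg
    obtain ⟨f', hf'⟩ := ih (g - D f) (natDegree_le_pred hf.1 hf.2)
    exact ⟨f + f', by rw [map_add, hf']; ring⟩

theorem iterate_D_eq_zero (h : IsLatticeCalculus α c κ D S) (hs : IsLatticeSeq α A G) {n : ℕ} :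
    ∀ {f : ℂ[X]}, f.natDegree < n → D^[n] f = 0 := by
  induction n with
  | zero => intro f hf; omega
  | succ n ih =>
    intro f hf
    rw [Function.iterate_succ_apply]
    cases n with
    | zero => exact h.D_eq_zero (by omega)
    | succ n =>
      have h1 := (h.hasTopCoeff_succ hs n (f := f) ⟨by omega, rfl⟩).1.1
      exact ih (by omega)

theorem norm_ne_zero (h : IsLatticeCalculus α c κ D S) (hs : IsLatticeSeq α A G) {f : ℂ[X]}
    (hf : f ≠ 0) : S f ^ 2 - latticeU₂ α c κ * D f ^ 2 ≠ 0 := by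
  intro h0
  have hl : f.leadingCoeff ≠ 0 := leadingCoeff_ne_zero.2 hf
  have htop : HasTopCoeff f f.natDegree f.leadingCoeff := ⟨le_rfl, rfl⟩
  have hS := h.hasTopCoeff_S hs htop
  have hSS := hS.mul hS
  rcases hn : f.natDegree with _ | n
  · rw [h.D_eq_zero hn] at h0
    rw [eq_C_of_natDegree_eq_zero hn, h.S_C] at h0
    rw [leadingCoeff, hn] at hl
    simp [hl] at h0
  · rw [hn] at htop hSS
    have hD := (h.hasTopCoeff_succ hs n htop).1
    have h1 := ((hasTopCoeff_latticeU₂ α c κ).mul (hD.mul hD)).neg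
    rw [show 2 + (n + n) = n + 1 + (n + 1) by ring] at h1
    have h2 := (hSS.add h1).2
    rw [← sub_eq_add_neg, ← pow_two, ← pow_two, h0, coeff_zero] at h2
    apply pow_ne_zero 2 hl
    linear_combination -h2 - f.leadingCoeff ^ 2 * hs.sq_sub_sq (n + 1)

end IsLatticeCalculus

/-- `P` is the monic orthogonal polynomial sequence of the functional `u`. -/
structure IsMonicOPS (u : ℂ[X] →ₗ[ℂ] ℂ) (P : ℕ → ℂ[X]) : Prop where
  monic : ∀ n, (P n).Monic
  natDegree : ∀ n, (P n).natDegree = n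
  orthogonal : ∀ n m, n ≠ m → u (P n * P m) = 0
  ne_zero : ∀ n, u (P n * P n) ≠ 0

namespace IsMonicOPS

variable {u : ℂ[X] →ₗ[ℂ] ℂ} {P : ℕ → ℂ[X]}

theorem hasTopCoeff (hP : IsMonicOPS u P) (n : ℕ) : HasTopCoeff (P n) n 1 := by
  have h := hP.monic n
  rw [Monic, leadingCoeff, hP.natDegree] at h
  exact ⟨(hP.natDegree n).le, h⟩

theorem hasTopCoeff_sub (hP : IsMonicOPS u P) {w : ℂ[X]} {m : ℕ} {a : ℂ}
    (hw : HasTopCoeff w m a) : HasTopCoeff (w - C a * P m) m 0 := by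
  rw [sub_eq_add_neg]
  convert hw.add ((hP.hasTopCoeff m).C_mul a).neg using 1
  ring

theorem map_mul_eq_zero (hP : IsMonicOPS u P) {n : ℕ} :
    ∀ {w : ℂ[X]}, w.natDegree < n → u (w * P n) = 0 := by
  suffices H : ∀ m < n, ∀ w : ℂ[X], w.natDegree ≤ m → u (w * P n) = 0 from
    fun {w} hw => H _ hw w le_rfl
  intro m hm
  have step (w : ℂ[X]) (m : ℕ) (hm : m < n) : u (w * P n) = u ((w - C (w.coeff m) * P m) * P n) := by
    rw [sub_mul, map_sub, mul_assoc, ← smul_eq_C_mul, map_smul, hP.orthogonal m n hm.ne,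
      smul_zero, sub_zero]
  induction m with
  | zero =>
    intro w hw
    have h1 := hP.hasTopCoeff_sub ⟨hw, rfl⟩
    rw [step w 0 hm, eq_C_of_natDegree_le_zero h1.1, h1.2]
    simp
  | succ m ih =>
    intro w hw
    have h1 := hP.hasTopCoeff_sub ⟨hw, rfl⟩
    rw [step w _ hm]
    exact ih (by omega) _ (natDegree_le_pred h1.1 h1.2)

theorem eq_zero_of_forall (hP : IsMonicOPS u P) {w : ℂ[X]}
    (hw : ∀ m ≤ w.natDegree, u (w * P m) = 0) : w = 0 := by
  by_contra h0
  set m := w.natDegree with hm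
  have htop : HasTopCoeff w m w.leadingCoeff := ⟨le_rfl, rfl⟩
  have h1 := hP.hasTopCoeff_sub htop
  have h2 : u ((w - C w.leadingCoeff * P m) * P m) = 0 := by
    rcases Nat.eq_zero_or_pos m with h | h
    · rw [h] at h1 ⊢
      rw [eq_C_of_natDegree_le_zero h1.1, h1.2]
      simp
    · have := natDegree_le_pred h1.1 h1.2
      exact hP.map_mul_eq_zero (by omega)
  rw [sub_mul, map_sub, hw m le_rfl, mul_assoc, ← smul_eq_C_mul, map_smul, smul_eq_mul, zero_sub,
    neg_eq_zero] at h2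
  exact mul_ne_zero (leadingCoeff_ne_zero.2 h0) (hP.ne_zero m) h2

theorem eq_C_mul (hP : IsMonicOPS u P) {w : ℂ[X]} {n : ℕ} {a : ℂ} (hw : HasTopCoeff w n a)
    (h : ∀ g : ℂ[X], g.natDegree < n → u (w * g) = 0) : w = C a * P n := by
  have h1 := hP.hasTopCoeff_sub hw
  rw [← sub_eq_zero]
  rcases Nat.eq_zero_or_pos n with h0 | h0
  · rw [h0] at h1 ⊢
    rw [eq_C_of_natDegree_le_zero h1.1, h1.2, C_0]
  · have h2 := natDegree_le_pred h1.1 h1.2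
    apply hP.eq_zero_of_forall
    intro m hm
    have hmn : m < n := by omega
    rw [sub_mul, map_sub, h _ (by rw [hP.natDegree]; exact hmn), mul_assoc, ← smul_eq_C_mul,
      map_smul, hP.orthogonal n m hmn.ne', smul_zero, sub_zero]

theorem map_one_ne_zero (hP : IsMonicOPS u P) : u 1 ≠ 0 := by
  have h := hP.ne_zero 0
  rwa [(hP.monic 0).natDegree_eq_zero.1 (hP.natDegree 0), mul_one] at h

end IsMonicOPS

namespace IsLatticeCalculus

variable {α c κ : ℂ} {D S : ℂ[X] →ₗ[ℂ] ℂ[X]} {A G : ℕ → ℂ}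

/-- A regular functional satisfying a Pearson equation is admissible. -/
theorem admissible (h : IsLatticeCalculus α c κ D S) (hs : IsLatticeSeq α A G)
    (hG : ∀ n, G (n + 1) ≠ 0) {u : ℂ[X] →ₗ[ℂ] ℂ} {P : ℕ → ℂ[X]} (hP : IsMonicOPS u P)
    {φ ψ : ℂ[X]} {a d : ℂ} (hφ : HasTopCoeff φ 2 a) (hψ : HasTopCoeff ψ 1 d)
    (hne : φ ≠ 0 ∨ ψ ≠ 0) (hu : ∀ f, u (φ * D f) + u (ψ * S f) = 0) (n : ℕ) :
    a * G n + d * A n ≠ 0 := by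
  intro h0
  have hmem (f : ℂ[X]) : f ∈ degreeLT ℂ (n + 1) ↔ f.natDegree ≤ n := by
    rw [degreeLT_succ_eq_degreeLE, mem_degreeLE, natDegree_le_iff_degree_le]
  let R : ℂ[X] →ₗ[ℂ] ℂ[X] := LinearMap.mulLeft ℂ φ ∘ₗ D + LinearMap.mulLeft ℂ ψ ∘ₗ S
  have hR : ∀ f, R f = φ * D f + ψ * S f := fun f => rfl
  have hmaps : ∀ f ∈ degreeLT ℂ (n + 1), R f ∈ degreeLT ℂ (n + 1) := by
    intro f hf
    rw [hmem] at hf ⊢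
    have h1 := h.hasTopCoeff_pearson hs hφ hψ ⟨hf, rfl⟩
    rw [h0, zero_mul] at h1
    exact natDegree_le_pred h1.1 h1.2
  have hns : ¬ Function.Surjective (R.restrict hmaps) := by
    intro hsurj
    obtain ⟨f, hf⟩ := hsurj ⟨1, by rw [hmem]; simp⟩
    have hf' : R f = 1 := congrArg Subtype.val hf
    apply hP.map_one_ne_zero
    rw [← hf', hR, map_add, hu]
  have : FiniteDimensional ℂ (degreeLT ℂ (n + 1)) :=
    Module.Finite.equiv (degreeLTEquiv ℂ (n + 1)).symm
  rw [← LinearMap.injective_iff_surjective, ← LinearMap.ker_eq_bot, Submodule.eq_bot_iff] at hns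
  push Not at hns
  obtain ⟨⟨f, hfm⟩, hf, hf0⟩ := hns
  have hf0' : f ≠ 0 := fun e => hf0 (Subtype.ext e)
  have hRf : φ * D f + ψ * S f = 0 := congrArg Subtype.val (LinearMap.mem_ker.1 hf)
  set w := φ * S f + latticeU₂ α c κ * ψ * D f with hw
  have hw0 : w = 0 := by
    apply hP.eq_zero_of_forall
    intro m _
    obtain ⟨g, hg⟩ := h.D_surjective hs hG (P m)
    have h1 := hu (f * g)
    rw [← map_add, h.D_mul, h.S_mul] at h1
    rw [← hg, ← h1]
    congr 1
    linear_combination -S g * hRf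
  have hN := h.norm_ne_zero hs hf0'
  rcases hne with h1 | h1
  · apply mul_ne_zero h1 hN
    linear_combination S f * hw0 - latticeU₂ α c κ * D f * hRf - S f * hw
  · apply mul_ne_zero h1 hN
    linear_combination S f * hRf - D f * hw0 + D f * hw

/-- Transposition of the iterated divided difference through the shifted functionals. -/
theorem exists_transpose (h : IsLatticeCalculus α c κ D S) (hα : α ≠ 0)
    {U : ℕ → ℂ[X] →ₗ[ℂ] ℂ} {Phi Psi : ℕ → ℂ[X]} {e : ℕ → ℂ}
    (hpear : ∀ k f, U k (Phi k * D f) + U k (Psi k * S f) = 0)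
    (hrec : ∀ k f, U (k + 1) f = -(U k (latticeU₂ α c κ * Psi k * D f)) - U k (Phi k * S f))
    (htop : ∀ k n (f : ℂ[X]) l, HasTopCoeff f n l →
      HasTopCoeff (Phi k * D f + Psi k * S f) (n + 1) (e (2 * k + n) * l)) (n : ℕ) :
    ∀ (i : ℕ) (f : ℂ[X]) (l : ℂ), HasTopCoeff f i l →
      ∃ F : ℂ[X], HasTopCoeff F (n + i) ((∏ j ∈ Finset.range n, e (n + i + j - 1)) * l) ∧
        ∀ p, U n (f * D^[n] p) = α ^ n * U 0 (F * p) := by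
  induction n with
  | zero => intro i f l hf; exact ⟨f, by simpa using hf, by simp⟩
  | succ n ih =>
    intro i f l hf
    obtain ⟨F, hF, hFp⟩ := ih _ _ _ (htop n i f l hf)
    refine ⟨F, ?_, fun p => ?_⟩
    · convert hF using 1
      · ring
      · rw [Finset.prod_range_succ, mul_assoc]
        congr 1
        · refine Finset.prod_congr rfl fun j _ => ?_
          congr 2
          omega
        · congr 2
          omega
    · rw [Function.iterate_succ_apply', h.shift_mul_D hα (hpear n) (hrec n), hFp]
      ring

/-- The functional Rodrigues formula for an abstract lattice calculus. -/
theorem rodrigues (h : IsLatticeCalculus α c κ D S) (hα : α ≠ 0)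
    (hs : IsLatticeSeq α A G) (hG : ∀ n, G (n + 1) ≠ 0) {U : ℕ → ℂ[X] →ₗ[ℂ] ℂ} {P : ℕ → ℂ[X]}
    (hP : IsMonicOPS (U 0) P) {Phi Psi : ℕ → ℂ[X]} {a d : ℂ} (hφ : HasTopCoeff (Phi 0) 2 a)
    (hψ : HasTopCoeff (Psi 0) 1 d) (hne : Phi 0 ≠ 0 ∨ Psi 0 ≠ 0)
    (hu : ∀ f, U 0 (Phi 0 * D f) + U 0 (Psi 0 * S f) = 0)
    (hPhi : ∀ k, Phi (k + 1) =
      S (Phi k) + latticeU₁ α c * S (Psi k) + C α * latticeU₂ α c κ * D (Psi k))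
    (hPsi : ∀ k, Psi (k + 1) =
      D (Phi k) + C α * S (Psi k) + latticeU₁ α c * D (Psi k))
    (hrec : ∀ k f, U (k + 1) f = -(U k (latticeU₂ α c κ * Psi k * D f)) - U k (Phi k * S f))
    (n : ℕ) (g : ℂ[X]) :
    U 0 (P n * g) = ((-α) ^ n)⁻¹ *
      (∏ j ∈ Finset.range n, (a * G (n + j - 1) + d * A (n + j - 1))⁻¹) *
      (-1) ^ n * U n (D^[n] g) := by
  have hpear (k : ℕ) : ∀ f, U k (Phi k * D f) + U k (Psi k * S f) = 0 := by
    induction k with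
    | zero => exact hu
    | succ k ih => exact h.shift_pearson hα ih (hrec k) (hPhi k) (hPsi k)
  have hdata (k : ℕ) : ∃ a' d', HasTopCoeff (Phi k) 2 a' ∧ HasTopCoeff (Psi k) 1 d' ∧
      ∀ n, a' * G n + d' * A n = a * G (2 * k + n) + d * A (2 * k + n) := by
    induction k with
    | zero => exact ⟨a, d, hφ, hψ, by simp⟩
    | succ k ih =>
      obtain ⟨a', d', h1, h2, h3⟩ := ih
      refine ⟨_, _, hPhi k ▸ h.hasTopCoeff_shift_phi hs h1 h2,
        hPsi k ▸ h.hasTopCoeff_shift_psi hs h1 h2, fun n => ?_⟩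
      rw [show 2 * (k + 1) + n = 2 * k + (n + 2) by ring, ← h3]
      simp only [hs.A_succ, hs.G_succ]
      ring
  obtain ⟨F, hF, hFp⟩ := h.exists_transpose hα (e := fun m => a * G m + d * A m) hpear hrec
    (fun k m f l hf => by
      obtain ⟨a', d', h1, h2, h3⟩ := hdata k
      rw [← h3]
      exact h.hasTopCoeff_pearson hs h1 h2 hf) n 0 1 1 (by simp [HasTopCoeff])
  simp only [one_mul, mul_one, add_zero] at hF hFp
  have hF' := hP.eq_C_mul hF fun g hg => by
    have h1 := hFp g
    rw [h.iterate_D_eq_zero hs hg, map_zero] at h1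
    exact (mul_eq_zero.1 h1.symm).resolve_left (pow_ne_zero n hα)
  have hprod : ∏ j ∈ Finset.range n, (a * G (n + j - 1) + d * A (n + j - 1)) ≠ 0 :=
    Finset.prod_ne_zero_iff.2 fun j _ => h.admissible hs hG hP hφ hψ hne hu _
  rw [hFp, hF', mul_assoc (C _), ← smul_eq_C_mul, map_smul, smul_eq_mul, Finset.prod_inv_distrib,
    neg_pow α]
  have h1 : ((-1 : ℂ) ^ n) ≠ 0 := pow_ne_zero n (by norm_num)
  have h2 := pow_ne_zero n hα
  field_simp

end IsLatticeCalculus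

section Lattice

variable {q : ℝ} {c1 c2 c3 : ℂ}

theorem qp_add (q : ℝ) (s t : ℂ) : qp q (s + t) = qp q s * qp q t := by
  rw [qp, add_mul, Complex.exp_add, qp, qp]

theorem qp_neg (q : ℝ) (s : ℂ) : qp q (-s) = (qp q s)⁻¹ := by
  rw [qp, neg_mul, Complex.exp_neg, qp]

theorem qp_ne_zero (q : ℝ) (s : ℂ) : qp q s ≠ 0 := Complex.exp_ne_zero _

theorem qp_zero (q : ℝ) : qp q 0 = 1 := by simp [qp]

theorem qp_ofReal (q t : ℝ) : qp q t = (Real.exp (t * Real.log q) : ℝ) := by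
  simp [qp]

theorem qp_sub_qp_neg_ne_zero (hq : 0 < q) (hq1 : q ≠ 1) {t : ℝ} (ht : t ≠ 0) :
    qp q t - qp q (-t) ≠ 0 := by
  rw [← Complex.ofReal_neg, qp_ofReal, qp_ofReal, sub_ne_zero, Ne, Complex.ofReal_inj,
    Real.exp_eq_exp]
  have := mul_ne_zero ht (Real.log_ne_zero_of_pos_of_ne_one hq hq1)
  intro h
  apply this
  linarith

theorem qp_half_sub_ne_zero (hq : 0 < q) (hq1 : q ≠ 1) :
    qp q (1 / 2) - (qp q (1 / 2))⁻¹ ≠ 0 := by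
  have := qp_sub_qp_neg_ne_zero hq hq1 (t := 1 / 2) (by norm_num)
  rw [← qp_neg]
  simpa using this

theorem alphaL_eq (q : ℝ) : alphaL q = (qp q (1 / 2) + (qp q (1 / 2))⁻¹) / 2 := by
  rw [alphaL, qp_neg]

theorem alphaL_ne_zero (q : ℝ) : alphaL q ≠ 0 := by
  have h1 := qp_ofReal q (1 / 2)
  have h2 := qp_ofReal q (-(1 / 2))
  rw [Complex.ofReal_neg] at h2
  rw [show ((1 / 2 : ℝ) : ℂ) = 1 / 2 by norm_num] at h1 h2
  rw [alphaL, h1, h2]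
  norm_cast
  positivity

theorem isLatticeSeq (hq : 0 < q) (hq1 : q ≠ 1) :
    IsLatticeSeq (alphaL q) (alphaN q) (gammaN q) := by
  have hr := qp_half_sub_ne_zero hq hq1
  have hr0 := qp_ne_zero q (1 / 2)
  have hsucc (n : ℕ) : qp q ((n + 1 : ℕ) / 2) = qp q (n / 2) * qp q (1 / 2) := by
    rw [← qp_add]
    congr 1
    push_cast
    ring
  refine ⟨?_, ?_, fun n => ?_, fun n => ?_⟩
  · simp [alphaN, qp_zero]
  · simp [gammaN, qp_zero]
  all_goals
    simp only [alphaN, gammaN, alphaL_eq, qp_neg, hsucc]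
    have hR0 := qp_ne_zero q (n / 2)
    generalize qp q (n / 2) = R at *
    generalize qp q (1 / 2) = r at *
    obtain ⟨d, hd⟩ : ∃ d, r - r⁻¹ = d := ⟨_, rfl⟩
    rw [hd] at hr ⊢
    have hrd : r * d = r ^ 2 - 1 := by
      rw [← hd]
      field_simp
    field_simp
  · linear_combination (2 * (R ^ 2 * r ^ 2 + 1) - (r ^ 2 + 1) * (R ^ 2 + 1)) * hrd
  · linear_combination -(R ^ 2 + 1) * hrd

theorem gammaN_succ_ne_zero (hq : 0 < q) (hq1 : q ≠ 1) (n : ℕ) : gammaN q (n + 1) ≠ 0 := by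
  have h := qp_sub_qp_neg_ne_zero hq hq1 (t := ((n + 1 : ℕ) : ℝ) / 2) (by positivity)
  have h1 := qp_half_sub_ne_zero hq hq1
  rw [← qp_neg] at h1
  rw [gammaN]
  exact div_ne_zero (by simpa using h) h1

theorem latX_eq (q : ℝ) (c1 c2 c3 s : ℂ) :
    latX q c1 c2 c3 s = c1 * (qp q s)⁻¹ + c2 * qp q s + c3 := by
  rw [latX, qp_neg]

theorem latX_add_half (q : ℝ) (c1 c2 c3 s : ℂ) : latX q c1 c2 c3 (s + 1 / 2) =
    c1 * ((qp q s)⁻¹ * (qp q (1 / 2))⁻¹) + c2 * (qp q s * qp q (1 / 2)) + c3 := by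
  rw [latX_eq, qp_add, mul_inv]

theorem latX_sub_half (q : ℝ) (c1 c2 c3 s : ℂ) : latX q c1 c2 c3 (s - 1 / 2) =
    c1 * ((qp q s)⁻¹ * qp q (1 / 2)) + c2 * (qp q s * (qp q (1 / 2))⁻¹) + c3 := by
  rw [latX_eq, sub_eq_add_neg, qp_add, qp_neg, mul_inv, inv_inv]

theorem latX_surjective (hq : 0 < q) (hq1 : q ≠ 1) (hc : c1 * c2 ≠ 0) (c3 : ℂ) :
    Function.Surjective (latX q c1 c2 c3) := by
  intro z
  have hc1 := left_ne_zero_of_mul hc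
  have hc2 := right_ne_zero_of_mul hc
  obtain ⟨δ, hδ⟩ := IsAlgClosed.exists_pow_nat_eq ((z - c3) ^ 2 - 4 * c1 * c2) two_pos
  set w := (z - c3 + δ) / (2 * c2) with hw
  have hw2 : c2 * w ^ 2 - (z - c3) * w + c1 = 0 := by
    rw [hw]
    field_simp
    linear_combination hδ
  have hw0 : w ≠ 0 := by
    intro h
    rw [h] at hw2
    apply hc1
    linear_combination hw2
  have hl : (Real.log q : ℂ) ≠ 0 := Complex.ofReal_ne_zero.2 (Real.log_ne_zero_of_pos_of_ne_one hq hq1)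
  refine ⟨Complex.log w / Real.log q, ?_⟩
  rw [latX_eq, qp, div_mul_cancel₀ _ hl, Complex.exp_log hw0]
  field_simp
  linear_combination hw2

theorem sq_latX_sub (q : ℝ) (c1 c2 c3 s : ℂ) :
    (latX q c1 c2 c3 (s + 1 / 2) - latX q c1 c2 c3 (s - 1 / 2)) ^ 2 =
      4 * (alphaL q ^ 2 - 1) * ((latX q c1 c2 c3 s - c3) ^ 2 - 4 * c1 * c2) := by
  rw [latX_add_half, latX_sub_half, latX_eq, alphaL_eq]
  have := qp_ne_zero q s
  have := qp_ne_zero q (1 / 2)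
  field_simp
  ring

theorem alphaL_sq_sub_one_ne_zero (hq : 0 < q) (hq1 : q ≠ 1) : alphaL q ^ 2 - 1 ≠ 0 := by
  have h : alphaL q ^ 2 - 1 = ((qp q (1 / 2) - (qp q (1 / 2))⁻¹) / 2) ^ 2 := by
    have := qp_ne_zero q (1 / 2)
    rw [alphaL_eq]
    field_simp
    ring
  rw [h]
  exact pow_ne_zero 2 (div_ne_zero (qp_half_sub_ne_zero hq hq1) two_ne_zero)

theorem eq_of_eval_latX (hq : 0 < q) (hq1 : q ≠ 1) (hc : c1 * c2 ≠ 0) {p p' : ℂ[X]}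
    (h : ∀ s, latX q c1 c2 c3 (s + 1 / 2) ≠ latX q c1 c2 c3 (s - 1 / 2) →
      p.eval (latX q c1 c2 c3 s) = p'.eval (latX q c1 c2 c3 s)) : p = p' := by
  have hT : (X - C c3) ^ 2 - C (4 * c1 * c2) ≠ 0 := by
    intro h0
    have := congrArg (eval c3) h0
    simp only [eval_sub, eval_pow, eval_X, eval_C, sub_self, eval_zero] at this
    apply hc
    linear_combination (-1 / 4) * this
  rw [← sub_eq_zero]
  refine (mul_eq_zero.1 (Polynomial.funext fun z => ?_)).resolve_right hT
  obtain ⟨s, rfl⟩ := latX_surjective hq hq1 hc c3 z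
  simp only [eval_mul, eval_sub, eval_pow, eval_X, eval_C, eval_zero]
  by_cases hs : latX q c1 c2 c3 (s + 1 / 2) = latX q c1 c2 c3 (s - 1 / 2)
  · have h1 := sq_latX_sub q c1 c2 c3 s
    rw [hs, sub_self, zero_pow two_ne_zero] at h1
    have h2 := (mul_eq_zero.1 h1.symm).resolve_left
      (mul_ne_zero (by norm_num) (alphaL_sq_sub_one_ne_zero hq hq1))
    rw [h2, mul_zero]
  · rw [h s hs, sub_self, zero_mul]

/-- Operators given by divided differences and averages on a lattice are linear and obey the
lattice calculus. -/
theorem exists_isLatticeCalculus (hq : 0 < q) (hq1 : q ≠ 1) (hc : c1 * c2 ≠ 0)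
    {Dx Sx : ℂ[X] → ℂ[X]}
    (hDx : ∀ (f : ℂ[X]) (s : ℂ),
      latX q c1 c2 c3 (s + 1/2) ≠ latX q c1 c2 c3 (s - 1/2) →
      (Dx f).eval (latX q c1 c2 c3 s) =
        (f.eval (latX q c1 c2 c3 (s + 1/2)) - f.eval (latX q c1 c2 c3 (s - 1/2))) /
          (latX q c1 c2 c3 (s + 1/2) - latX q c1 c2 c3 (s - 1/2)))
    (hSx : ∀ (f : ℂ[X]) (s : ℂ),
      (Sx f).eval (latX q c1 c2 c3 s) =
        (f.eval (latX q c1 c2 c3 (s + 1/2)) + f.eval (latX q c1 c2 c3 (s - 1/2))) / 2) :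
    ∃ D S : ℂ[X] →ₗ[ℂ] ℂ[X], ⇑D = Dx ∧ ⇑S = Sx ∧
      IsLatticeCalculus (alphaL q) c3 (4 * c1 * c2) D S := by
  refine ⟨{ toFun := Dx, map_add' := fun f g => ?_, map_smul' := fun a f => ?_ },
    { toFun := Sx, map_add' := fun f g => ?_, map_smul' := fun a f => ?_ }, rfl, rfl,
    ⟨?_, ?_, ?_, fun f g => ?_, fun f g => ?_⟩⟩
  all_goals
    refine eq_of_eval_latX (c3 := c3) hq hq1 hc fun s hs => ?_
    have hs' := sub_ne_zero.2 hs
    simp only [LinearMap.coe_mk, AddHom.coe_mk, RingHom.id_apply, eval_add, eval_mul, eval_smul,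
      smul_eq_mul, hDx _ s hs, hSx, eval_X, eval_one, eval_C, eval_sub]
  · ring
  · ring
  · ring
  · ring
  · exact div_self hs'
  · rw [latX_add_half, latX_sub_half, latX_eq, alphaL_eq]
    ring
  · norm_num
  · field_simp
    ring
  · have h2 : eval (latX q c1 c2 c3 s) (latticeU₂ (alphaL q) c3 (4 * c1 * c2)) =
        (latX q c1 c2 c3 (s + 1 / 2) - latX q c1 c2 c3 (s - 1 / 2)) ^ 2 / 4 := by
      rw [sq_latX_sub]
      simp only [latticeU₂, eval_mul, eval_C, eval_sub, eval_pow, eval_X]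
      ring
    rw [h2]
    generalize latX q c1 c2 c3 (s + 1 / 2) - latX q c1 c2 c3 (s - 1 / 2) = d at hs' ⊢
    field_simp
    ring

end Lattice

theorem stmt_13 (q : ℝ) (hq : 0 < q) (hq1 : q ≠ 1) (c1 c2 c3 : ℂ) (hc : c1 * c2 ≠ 0)
    (Dx Sx : Polynomial ℂ → Polynomial ℂ)
    (hDx : ∀ (f : Polynomial ℂ) (s : ℂ),
      latX q c1 c2 c3 (s + 1/2) ≠ latX q c1 c2 c3 (s - 1/2) →
      (Dx f).eval (latX q c1 c2 c3 s) =
        (f.eval (latX q c1 c2 c3 (s + 1/2)) - f.eval (latX q c1 c2 c3 (s - 1/2))) /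
          (latX q c1 c2 c3 (s + 1/2) - latX q c1 c2 c3 (s - 1/2)))
    (hSx : ∀ (f : Polynomial ℂ) (s : ℂ),
      (Sx f).eval (latX q c1 c2 c3 s) =
        (f.eval (latX q c1 c2 c3 (s + 1/2)) + f.eval (latX q c1 c2 c3 (s - 1/2))) / 2)
    (pa pb pc pd pe : ℂ)
    (hne : ¬(pa = 0 ∧ pb = 0 ∧ pc = 0 ∧ pd = 0 ∧ pe = 0))
    (u : Polynomial ℂ →ₗ[ℂ] ℂ)
    (P : ℕ → Polynomial ℂ)
    (hPm : ∀ n, (P n).Monic) (hPd : ∀ n, (P n).natDegree = n)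
    (hPo : ∀ n m, n ≠ m → u (P n * P m) = 0)
    (hPn : ∀ n, u (P n * P n) ≠ 0)
    (hu : u ≠ 0)
    (hPearson : ∀ f : Polynomial ℂ,
      u ((C pa * X ^ 2 + C pb * X + C pc) * Dx f) + u ((C pd * X + C pe) * Sx f) = 0)
    (Phi Psi : ℕ → Polynomial ℂ)
    (hPhi0 : Phi 0 = C pa * X ^ 2 + C pb * X + C pc)
    (hPsi0 : Psi 0 = C pd * X + C pe)
    (hPhiRec : ∀ k, Phi (k + 1) =
      Sx (Phi k) + U1L q c3 * Sx (Psi k) + C (alphaL q) * U2L q c1 c2 c3 * Dx (Psi k))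
    (hPsiRec : ∀ k, Psi (k + 1) =
      Dx (Phi k) + C (alphaL q) * Sx (Psi k) + U1L q c3 * Dx (Psi k))
    (U : ℕ → (Polynomial ℂ →ₗ[ℂ] ℂ))
    (hU0 : U 0 = u)
    (hURec : ∀ k (f : Polynomial ℂ),
      U (k + 1) f = -(U k (U2L q c1 c2 c3 * Psi k * Dx f)) - U k (Phi k * Sx f)) :
    ∀ (n : ℕ) (g : Polynomial ℂ),
      u (P n * g) =
        ((-alphaL q) ^ n)⁻¹ * (∏ j ∈ Finset.range n, (dN q pa pd (n + j - 1))⁻¹) *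
          (-1 : ℂ) ^ n * U n (Dx^[n] g) := by
  obtain ⟨D, S, rfl, rfl, h⟩ := exists_isLatticeCalculus hq hq1 hc hDx hSx
  subst hU0
  have hφ : HasTopCoeff (Phi 0) 2 pa := by
    rw [hPhi0]
    exact ⟨natDegree_quadratic_le, by simp⟩
  have hψ : HasTopCoeff (Psi 0) 1 pd := by
    rw [hPsi0]
    exact ⟨natDegree_linear_le, by simp⟩
  have hne' : Phi 0 ≠ 0 ∨ Psi 0 ≠ 0 := by
    by_contra! h0
    rw [hPhi0, hPsi0] at h0
    obtain ⟨h1, h2⟩ := h0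
    have e (p : ℂ[X]) (hp : p = 0) (n : ℕ) : p.coeff n = 0 := by rw [hp, coeff_zero]
    have a0 := e _ h1 0
    have a1 := e _ h1 1
    have a2 := e _ h1 2
    have b0 := e _ h2 0
    have b1 := e _ h2 1
    simp [coeff_C, coeff_X] at a0 a1 a2 b0 b1
    exact hne ⟨a2, a1, a0, b1, b0⟩
  exact h.rodrigues (alphaL_ne_zero q) (isLatticeSeq hq hq1) (gammaN_succ_ne_zero hq hq1)
    ⟨hPm, hPd, hPo, hPn⟩ hφ hψ hne' (by rw [hPhi0, hPsi0]; exact hPearson) hPhiRec hPsiRec hURec
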